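/- Let i, j be natural numbers and β, β*, d, d* positive reals with either d* < d, or d* = d and β* < β. Then ∫₀^∞ x^i e^{-β x^d} γ((j+1)/d*, β* x^{d*}) dx = ∑_{k=0}^∞ (-1)^k β*^{(j+1)/d* + k} / (k! ((j+1)/d* + k)) · Γ((i + j + k d* + 2)/d) / (d β^{(i + j + k d* + 2)/d}), where γ(s, z) = ∫₀^z y^{s-1} e^{-y} dy is the lower incomplete Gamma function and the series on the right converges absolutely. -/

import Mathlib

open MeasureTheory Set

/-- The lower incomplete Gamma function `γ(s, z) = ∫₀^z y^(s-1) e^(-y) dy`. -/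
noncomputable def lowerGamma (s z : ℝ) : ℝ :=
  ∫ y in (0 : ℝ)..z, y ^ (s - 1) * Real.exp (-y)

theorem hasSum_pow_div_factorial_exp (y : ℝ) :
    HasSum (fun k : ℕ => y ^ k / (k.factorial : ℝ)) (Real.exp y) := by
  rw [Real.exp_eq_exp_ℝ]
  exact NormedSpace.expSeries_div_hasSum_exp y

/-- The power series of the lower incomplete Gamma function. -/
theorem hasSum_lowerGamma {s z : ℝ} (hs : 0 < s) (hz : 0 < z) :
    HasSum (fun k : ℕ => (-1 : ℝ) ^ k * z ^ (s + k) / ((k.factorial : ℝ) * (s + k)))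
      (lowerGamma s z) := by
  have hterm (k : ℕ) : ∫ y in (0 : ℝ)..z, y ^ (s - 1) * ((-y) ^ k / (k.factorial : ℝ)) =
      (-1 : ℝ) ^ k * z ^ (s + k) / ((k.factorial : ℝ) * (s + k)) := by
    have hk : 0 < s + k := by positivity
    have hcongr : ∫ y in (0 : ℝ)..z, y ^ (s - 1) * ((-y) ^ k / (k.factorial : ℝ)) =
        ∫ y in (0 : ℝ)..z, (-1 : ℝ) ^ k / (k.factorial : ℝ) * y ^ (s - 1 + k) := by
      refine intervalIntegral.integral_congr_ae (.of_forall fun y hy => ?_)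
      rw [uIoc_of_le hz.le] at hy
      rw [Real.rpow_add hy.1, Real.rpow_natCast, neg_pow]
      ring
    rw [hcongr, intervalIntegral.integral_const_mul, integral_rpow (.inl (by linarith)),
      show s - 1 + k + 1 = s + k by ring, Real.zero_rpow hk.ne', sub_zero]
    field_simp
  simp_rw [← hterm]
  have hrpow : IntervalIntegrable (fun y : ℝ => y ^ (s - 1)) volume 0 z :=
    intervalIntegral.intervalIntegrable_rpow' (by linarith)
  refine intervalIntegral.hasSum_integral_of_dominated_convergence
    (fun k y => y ^ (s - 1) * (y ^ k / (k.factorial : ℝ))) (fun k => ?_) (fun k => ?_) ?_ ?_ ?_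
  · exact (by fun_prop : Measurable fun y : ℝ =>
      y ^ (s - 1) * ((-y) ^ k / (k.factorial : ℝ))).aestronglyMeasurable
  · refine .of_forall fun y hy => ?_
    rw [uIoc_of_le hz.le] at hy
    have hy0 := hy.1
    rw [norm_mul, norm_div, norm_pow, norm_neg, Real.norm_of_nonneg hy0.le,
      Real.norm_of_nonneg (Real.rpow_nonneg hy0.le _), Real.norm_natCast]
  · exact .of_forall fun y _ => (hasSum_pow_div_factorial_exp y).summable.mul_left _
  · simp_rw [fun y : ℝ => ((hasSum_pow_div_factorial_exp y).mul_left (y ^ (s - 1))).tsum_eq]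
    exact hrpow.mul_continuousOn Real.continuous_exp.continuousOn
  · exact .of_forall fun y _ => (hasSum_pow_div_factorial_exp (-y)).mul_left _

/-- A dominated exponent is bounded above by a constant minus a positive multiple of the
dominating power. -/
theorem exists_mul_rpow_sub_le {β β' d d' : ℝ} (hβ : 0 < β) (hβ' : 0 < β') (hd' : 0 < d')
    (hdom : d' < d ∨ (d' = d ∧ β' < β)) :
    ∃ b C : ℝ, 0 < b ∧ ∀ x : ℝ, 0 < x → -β * x ^ d + β' * x ^ d' ≤ C + -b * x ^ d := by
  rcases hdom with h | ⟨rfl, h⟩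
  · set R : ℝ := (2 * β' / β) ^ (d - d')⁻¹ with hR
    have hR0 : 0 < R := by positivity
    have hRpow : R ^ (d - d') = 2 * β' / β := by
      rw [hR, Real.rpow_inv_rpow (by positivity) (sub_pos.2 h).ne']
    refine ⟨β / 2, β' * R ^ d', by positivity, fun x hx => ?_⟩
    have hxd : 0 < x ^ d := by positivity
    rcases le_total x R with hxR | hxR
    · have : x ^ d' ≤ R ^ d' := Real.rpow_le_rpow hx.le hxR hd'.le
      nlinarith [mul_le_mul_of_nonneg_left this hβ'.le, mul_pos hβ hxd]
    · have hle : 2 * β' / β ≤ x ^ (d - d') :=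
        hRpow ▸ Real.rpow_le_rpow hR0.le hxR (sub_pos.2 h).le
      rw [div_le_iff₀ hβ] at hle
      have hsplit : x ^ d = x ^ (d - d') * x ^ d' := by
        rw [← Real.rpow_add hx, sub_add_cancel]
      have hxd' : 0 < x ^ d' := by positivity
      have hRd' : 0 < β' * R ^ d' := by positivity
      have := mul_le_mul_of_nonneg_right hle hxd'.le
      rw [hsplit]
      linarith
  · exact ⟨β - β', 0, sub_pos.2 h, fun x _ => by linarith⟩

theorem integrableOn_rpow_mul_exp_add {q β β' d d' : ℝ} (hq : -1 < q) (hβ : 0 < β)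
    (hβ' : 0 < β') (hd : 0 < d) (hd' : 0 < d') (hdom : d' < d ∨ (d' = d ∧ β' < β)) :
    IntegrableOn (fun x : ℝ => x ^ q * Real.exp (-β * x ^ d + β' * x ^ d')) (Ioi 0) := by
  obtain ⟨b, C, hb, hle⟩ := exists_mul_rpow_sub_le hβ hβ' hd' hdom
  refine ((integrableOn_rpow_mul_exp_neg_mul_rpow hq hd hb).const_mul (Real.exp C)).mono'
    (by fun_prop : Measurable fun x : ℝ =>
      x ^ q * Real.exp (-β * x ^ d + β' * x ^ d')).aestronglyMeasurable ?_
  refine (ae_restrict_iff' measurableSet_Ioi).2 (.of_forall fun x (hx : 0 < x) => ?_)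
  rw [Real.norm_of_nonneg (by positivity), mul_left_comm, ← Real.exp_add]
  exact mul_le_mul_of_nonneg_left (Real.exp_le_exp.2 (hle x hx)) (by positivity)

/-- Key integral in the proof of the stress-strength formula: for naturals `i, j`
and positive reals `β, β*, d, d*` with `d* < d`, or `d* = d` and `β* < β`,
`∫₀^∞ xⁱ e^(-β x^d) γ((j+1)/d*, β* x^(d*)) dx
  = ∑_{k=0}^∞ (-1)^k β*^((j+1)/d* + k) / (k! ((j+1)/d* + k)) ·
      Γ((i+j+k d*+2)/d) / (d β^((i+j+k d*+2)/d))`,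
with the series converging absolutely. -/
theorem paper_stress_strength_integral (i j : ℕ) (β β' d d' : ℝ)
    (hβ : 0 < β) (hβ' : 0 < β') (hd : 0 < d) (hd' : 0 < d')
    (hdom : d' < d ∨ (d' = d ∧ β' < β)) :
    HasSum (fun k : ℕ =>
        (-1 : ℝ) ^ k * β' ^ (((j : ℝ) + 1) / d' + (k : ℝ)) /
            ((k.factorial : ℝ) * (((j : ℝ) + 1) / d' + (k : ℝ))) *
          (Real.Gamma (((i : ℝ) + (j : ℝ) + (k : ℝ) * d' + 2) / d) /
            (d * β ^ (((i : ℝ) + (j : ℝ) + (k : ℝ) * d' + 2) / d))))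
      (∫ x in Ioi (0 : ℝ),
        x ^ i * Real.exp (-β * x ^ d) *
          lowerGamma (((j : ℝ) + 1) / d') (β' * x ^ d')) ∧
    Summable (fun k : ℕ =>
        |(-1 : ℝ) ^ k * β' ^ (((j : ℝ) + 1) / d' + (k : ℝ)) /
              ((k.factorial : ℝ) * (((j : ℝ) + 1) / d' + (k : ℝ))) *
            (Real.Gamma (((i : ℝ) + (j : ℝ) + (k : ℝ) * d' + 2) / d) /
              (d * β ^ (((i : ℝ) + (j : ℝ) + (k : ℝ) * d' + 2) / d)))|) := by
  set s : ℝ := ((j : ℝ) + 1) / d' with hs_def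
  have hs : 0 < s := by positivity
  have hds : d' * s = j + 1 := by rw [hs_def]; field_simp
  have hterm (k : ℕ) : ∫ x in Ioi (0 : ℝ), x ^ i * Real.exp (-β * x ^ d) *
        ((-1 : ℝ) ^ k * (β' * x ^ d') ^ (s + k) / ((k.factorial : ℝ) * (s + k))) =
      (-1 : ℝ) ^ k * β' ^ (s + k) / ((k.factorial : ℝ) * (s + k)) *
        (Real.Gamma (((i : ℝ) + j + k * d' + 2) / d) /
          (d * β ^ (((i : ℝ) + j + k * d' + 2) / d))) := by
    have hq : (-1 : ℝ) < i + (j + 1 + k * d') := by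
      have : (0 : ℝ) ≤ i + (j + 1 + k * d') := by positivity
      linarith
    have hcongr : ∀ x ∈ Ioi (0 : ℝ), x ^ i * Real.exp (-β * x ^ d) *
          ((-1 : ℝ) ^ k * (β' * x ^ d') ^ (s + k) / ((k.factorial : ℝ) * (s + k))) =
        (-1 : ℝ) ^ k * β' ^ (s + k) / ((k.factorial : ℝ) * (s + k)) *
          (x ^ ((i : ℝ) + (j + 1 + k * d')) * Real.exp (-β * x ^ d)) := by
      intro x (hx : 0 < x)
      rw [Real.mul_rpow hβ'.le (by positivity), ← Real.rpow_mul hx.le, mul_add, hds,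
        mul_comm d' (k : ℝ), Real.rpow_add hx (i : ℝ), Real.rpow_natCast]
      ring
    rw [setIntegral_congr_fun measurableSet_Ioi hcongr, integral_const_mul,
      integral_rpow_mul_exp_neg_mul_rpow hd hq hβ,
      show (i : ℝ) + (j + 1 + k * d') + 1 = i + j + k * d' + 2 by ring, neg_div,
      Real.rpow_neg hβ.le]
    field_simp
  have hsum : HasSum (fun k : ℕ =>
      (-1 : ℝ) ^ k * β' ^ (s + k) / ((k.factorial : ℝ) * (s + k)) *
        (Real.Gamma (((i : ℝ) + j + k * d' + 2) / d) /
          (d * β ^ (((i : ℝ) + j + k * d' + 2) / d))))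
      (∫ x in Ioi (0 : ℝ), x ^ i * Real.exp (-β * x ^ d) * lowerGamma s (β' * x ^ d')) := by
    simp_rw [← hterm]
    refine hasSum_integral_of_dominated_convergence
      (fun k x => x ^ i * Real.exp (-β * x ^ d) * ((β' * x ^ d') ^ s / s) *
        ((β' * x ^ d') ^ k / (k.factorial : ℝ))) (fun k => ?_) (fun k => ?_) ?_ ?_ ?_
    · exact (by fun_prop : Measurable fun x : ℝ => x ^ i * Real.exp (-β * x ^ d) *
        ((-1 : ℝ) ^ k * (β' * x ^ d') ^ (s + k) /
          ((k.factorial : ℝ) * (s + k)))).aestronglyMeasurable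
    · refine (ae_restrict_iff' measurableSet_Ioi).2 (.of_forall fun x (hx : 0 < x) => ?_)
      have hz : 0 < β' * x ^ d' := by positivity
      rw [norm_mul, norm_div, norm_mul ((-1 : ℝ) ^ k), norm_pow, norm_neg, norm_one, one_pow,
        one_mul, Real.norm_of_nonneg (by positivity), Real.norm_of_nonneg (by positivity),
        Real.norm_of_nonneg (by positivity), mul_assoc (x ^ i * _), Real.rpow_add hz,
        Real.rpow_natCast, div_mul_div_comm, mul_comm s]
      gcongr
      simp
    · exact .of_forall fun x => (hasSum_pow_div_factorial_exp _).summable.mul_left _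
    · simp_rw [fun x : ℝ => ((hasSum_pow_div_factorial_exp (β' * x ^ d')).mul_left
        (x ^ i * Real.exp (-β * x ^ d) * ((β' * x ^ d') ^ s / s))).tsum_eq]
      have hq : (-1 : ℝ) < i + (j + 1) := by
        have : (0 : ℝ) ≤ i + (j + 1) := by positivity
        linarith
      refine ((integrableOn_rpow_mul_exp_add hq hβ hβ' hd hd' hdom).const_mul
        (β' ^ s / s)).congr ?_
      refine (ae_restrict_iff' measurableSet_Ioi).2 (.of_forall fun x (hx : 0 < x) => ?_)
      dsimp only
      rw [Real.mul_rpow hβ'.le (by positivity), ← Real.rpow_mul hx.le, hds, Real.exp_add,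
        Real.rpow_add hx (i : ℝ), Real.rpow_natCast]
      ring
    · refine (ae_restrict_iff' measurableSet_Ioi).2 (.of_forall fun x (hx : 0 < x) => ?_)
      exact (hasSum_lowerGamma hs (by positivity)).mul_left _
  exact ⟨hsum, hsum.summable.abs⟩
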